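/- Let m, p be coprime integers with m ≥ 2 and p ≥ 2, and let z ∈ ℂ be such that 2z+1 is not a non-zero integer. Then for every θ ∈ (−π, π) and every h ∈ ℂ \ {0} with Re(e^{iθ}/h) > 1/π, the Laplace integral ∫_0^{∞} e^{−r e^{iθ}/h} (H_{m,p} * I_{m,p,z})(r e^{iθ}) e^{iθ} dr converges absolutely. In particular, for every θ ∈ (−π, π) the set of such h is non-empty, so the formal Borel transform of the z-coloured Jones series of the (m,p)-torus knot admits a Laplace transform with non-empty domain in every direction e^{iθ} with θ ∈ (−π, π): the series is Borel re-summable. -/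

import Mathlib

open Complex Filter MeasureTheory Metric Set Topology
open scoped Real Nat Classical

/-- The meromorphic function `F_{m,p,z}` of the paper, with the convention that
`sinh((2z+1)√(mp)x)/(2z+1)` is interpreted as its limit `√(mp)x` when `2z+1 = 0`. -/
noncomputable def Fmpz (m p : ℕ) (z x : ℂ) : ℂ :=
  ((if 2 * z + 1 = 0 then ((Real.sqrt ((m : ℝ) * (p : ℝ)) : ℂ) * x)
      else Complex.sinh ((2 * z + 1) * (Real.sqrt ((m : ℝ) * (p : ℝ)) : ℂ) * x) / (2 * z + 1))
    * Complex.sinh ((Real.sqrt ((m : ℝ) / (p : ℝ)) : ℂ) * x)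
    * Complex.sinh ((Real.sqrt ((p : ℝ) / (m : ℝ)) : ℂ) * x))
    / Complex.sinh ((Real.sqrt ((m : ℝ) * (p : ℝ)) : ℂ) * x)

/-- Since `F_{m,p,z}` is even, `Φ_{m,p,z}(ξ) = F_{m,p,z}(s)` for any `s` with `s² = ξ`
is well defined; we realise it using the principal square root `ξ^(1/2)`. -/
noncomputable def Phimpz (m p : ℕ) (z ξ : ℂ) : ℂ :=
  Fmpz m p z (ξ ^ ((1 : ℂ) / 2))

/-- `I_{m,p,z}(x) = (1/(2√π)) ∫_0^1 (t(1-t))^{-1/2} Φ_{m,p,z}(tx) dt`. -/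
noncomputable def Impz (m p : ℕ) (z x : ℂ) : ℂ :=
  (1 / (2 * ((Real.sqrt Real.pi : ℝ) : ℂ))) *
    ∫ t in (0:ℝ)..1, ((Real.sqrt (t * (1 - t)) : ℝ) : ℂ)⁻¹ * Phimpz m p z ((t : ℂ) * x)

/-- The convolution `(f*g)(x) = ∫_0^x f(x-ξ)g(ξ)dξ = x ∫_0^1 f((1-t)x) g(tx) dt`. -/
noncomputable def convBorel (f g : ℂ → ℂ) (x : ℂ) : ℂ :=
  x * ∫ t in (0:ℝ)..1, f ((1 - (t : ℂ)) * x) * g ((t : ℂ) * x)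

lemma norm_sinh_le_mul_exp (z : ℂ) : ‖Complex.sinh z‖ ≤ ‖z‖ * Real.exp ‖z‖ := by
  have h1 : ‖Complex.exp z - ∑ k ∈ Finset.range 1, z ^ k / (k ! : ℂ)‖
      ≤ ‖z‖ ^ 1 * Real.exp ‖z‖ := Complex.norm_exp_sub_sum_le_norm_mul_exp z 1
  have h2 : ‖Complex.exp (-z) - ∑ k ∈ Finset.range 1, (-z) ^ k / (k ! : ℂ)‖
      ≤ ‖-z‖ ^ 1 * Real.exp ‖-z‖ := Complex.norm_exp_sub_sum_le_norm_mul_exp (-z) 1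
  simp only [Finset.range_one, Finset.sum_singleton, pow_zero, Nat.factorial_zero, Nat.cast_one,
    div_one, pow_one, norm_neg] at h1 h2
  have h3 : Complex.sinh z = ((Complex.exp z - 1) - (Complex.exp (-z) - 1)) / 2 := by
    rw [Complex.sinh]; ring
  have h4 := norm_sub_le (Complex.exp z - 1) (Complex.exp (-z) - 1)
  rw [h3, norm_div, Complex.norm_ofNat]
  linarith

lemma norm_sinh_le_exp_norm (z : ℂ) : ‖Complex.sinh z‖ ≤ Real.exp ‖z‖ := by
  have h1 : ‖Complex.exp z‖ ≤ Real.exp ‖z‖ := Complex.norm_exp_le_exp_norm z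
  have h2 : ‖Complex.exp (-z)‖ ≤ Real.exp ‖z‖ := by
    simpa using Complex.norm_exp_le_exp_norm (-z)
  have h4 := norm_sub_le (Complex.exp z) (Complex.exp (-z))
  rw [Complex.sinh, norm_div, Complex.norm_ofNat]
  linarith

lemma re_le_norm_sinh {z : ℂ} (hz : 0 ≤ z.re) : z.re ≤ ‖Complex.sinh z‖ := by
  have h1 : z.re ≤ Real.sinh z.re := Real.self_le_sinh_iff.2 hz
  have h2 := norm_sub_norm_le (Complex.exp z) (Complex.exp (-z))
  rw [Complex.norm_exp, Complex.norm_exp, Complex.neg_re] at h2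
  rw [Real.sinh_eq] at h1
  rw [Complex.sinh, norm_div, Complex.norm_ofNat]
  linarith

/-- In the open right half-plane, `F_{m,p,z}` has exponential type, up to the factor `|x| / Re x`
measuring the distance to the imaginary axis, which carries the poles. -/
lemma norm_Fmpz_le {m p : ℕ} (hm : 0 < m) (hp : 0 < p) (z : ℂ) {x : ℂ} (hx : 0 < x.re) :
    ‖Fmpz m p z x‖ ≤ ‖x‖ / x.re * Real.exp ((‖2 * z + 1‖ * √((m : ℝ) * p) + √((m : ℝ) / p)
      + √((p : ℝ) / m)) * ‖x‖) := by
  set b := √((m : ℝ) * p) with hb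
  set a := √((m : ℝ) / p) with ha
  set d := √((p : ℝ) / m) with hd
  have hb0 : 0 < b := by positivity
  have ha0 : 0 ≤ a := Real.sqrt_nonneg _
  have hd0 : 0 ≤ d := Real.sqrt_nonneg _
  have hden : b * x.re ≤ ‖Complex.sinh ((b : ℂ) * x)‖ := by
    have := re_le_norm_sinh (z := (b : ℂ) * x) (by rw [Complex.re_ofReal_mul]; positivity)
    rwa [Complex.re_ofReal_mul] at this
  have hfirst : ‖if 2 * z + 1 = 0 then (b : ℂ) * x
      else Complex.sinh ((2 * z + 1) * (b : ℂ) * x) / (2 * z + 1)‖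
      ≤ b * ‖x‖ * Real.exp (‖2 * z + 1‖ * b * ‖x‖) := by
    split_ifs with h
    · simp [h, abs_of_pos hb0]
    · have hn : 0 < ‖2 * z + 1‖ := norm_pos_iff.2 h
      rw [norm_div, div_le_iff₀ hn]
      refine (norm_sinh_le_mul_exp _).trans_eq ?_
      simp only [norm_mul, Complex.norm_real, Real.norm_eq_abs, abs_of_pos hb0]
      ring
  have hs (t : ℝ) (ht : 0 ≤ t) : ‖Complex.sinh ((t : ℂ) * x)‖ ≤ Real.exp (t * ‖x‖) := by
    refine (norm_sinh_le_exp_norm _).trans_eq ?_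
    rw [norm_mul, Complex.norm_real, Real.norm_eq_abs, abs_of_nonneg ht]
  rw [Fmpz, norm_div, norm_mul, norm_mul]
  calc _ ≤ (b * ‖x‖ * Real.exp (‖2 * z + 1‖ * b * ‖x‖)) * Real.exp (a * ‖x‖) *
        Real.exp (d * ‖x‖) / (b * x.re) := by
        gcongr
        · exact hs a ha0
        · exact hs d hd0
    _ = _ := by
        rw [add_mul, add_mul, Real.exp_add, Real.exp_add]
        field_simp

lemma ray_cpow_half {θ : ℝ} (hθ : θ ∈ Ioo (-π) π) {r : ℝ} (hr : 0 < r) :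
    ((r : ℂ) * Complex.exp (Complex.I * θ)) ^ ((1 : ℂ) / 2)
      = (√r : ℂ) * Complex.exp (((θ / 2 : ℝ) : ℂ) * Complex.I) := by
  have hne : (r : ℂ) * Complex.exp (Complex.I * θ) ≠ 0 :=
    mul_ne_zero (by exact_mod_cast hr.ne') (Complex.exp_ne_zero _)
  have hlog : Complex.log ((r : ℂ) * Complex.exp (Complex.I * θ))
      = (Real.log r : ℂ) + Complex.I * θ := by
    rw [Complex.log_ofReal_mul hr (Complex.exp_ne_zero _), Complex.log_exp]
    · simpa using hθ.1
    · simpa using hθ.2.le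
  rw [Complex.cpow_def_of_ne_zero hne, hlog, Real.sqrt_eq_rpow, Real.rpow_def_of_pos hr,
    Complex.ofReal_exp, ← Complex.exp_add]
  congr 1
  push_cast
  ring

lemma exists_norm_Phimpz_ray_le {m p : ℕ} (hm : 0 < m) (hp : 0 < p) (z : ℂ) {θ : ℝ}
    (hθ : θ ∈ Ioo (-π) π) :
    ∃ A, 0 ≤ A ∧ ∀ r : ℝ, 0 ≤ r →
      ‖Phimpz m p z ((r : ℂ) * Complex.exp (Complex.I * θ))‖ ≤ A * Real.exp (r / π) := by
  have hcos : 0 < Real.cos (θ / 2) :=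
    Real.cos_pos_of_mem_Ioo ⟨by linarith [hθ.1], by linarith [hθ.2]⟩
  set K := ‖2 * z + 1‖ * √((m : ℝ) * p) + √((m : ℝ) / p) + √((p : ℝ) / m) with hK
  refine ⟨1 / Real.cos (θ / 2) * Real.exp (K ^ 2 * π / 4), by positivity, fun r hr => ?_⟩
  rcases hr.eq_or_lt with rfl | hr
  · have : Phimpz m p z (((0 : ℝ) : ℂ) * Complex.exp (Complex.I * θ)) = 0 := by
      simp [Phimpz, Fmpz]
    rw [this, norm_zero]
    positivity
  have hs : 0 < √r := Real.sqrt_pos.2 hr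
  have hre : ((√r : ℂ) * Complex.exp (((θ / 2 : ℝ) : ℂ) * Complex.I)).re
      = √r * Real.cos (θ / 2) := by
    rw [Complex.re_ofReal_mul, Complex.exp_ofReal_mul_I_re]
  have hnorm : ‖(√r : ℂ) * Complex.exp (((θ / 2 : ℝ) : ℂ) * Complex.I)‖ = √r := by
    rw [norm_mul, Complex.norm_exp_ofReal_mul_I, Complex.norm_real, Real.norm_eq_abs,
      abs_of_pos hs, mul_one]
  rw [Phimpz, ray_cpow_half hθ hr]
  refine (norm_Fmpz_le hm hp z (by rw [hre]; positivity)).trans ?_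
  rw [hre, hnorm, ← hK, mul_assoc _ (Real.exp (K ^ 2 * π / 4)), ← Real.exp_add]
  have hq : √r / (√r * Real.cos (θ / 2)) = 1 / Real.cos (θ / 2) := by field_simp
  rw [hq]
  gcongr
  have hsq : √r ^ 2 = r := Real.sq_sqrt hr.le
  have hamgm : 0 ≤ (K * π / 2 - √r) ^ 2 / π := by positivity
  have hexpand : (K * π / 2 - √r) ^ 2 / π = K ^ 2 * π / 4 - K * √r + √r ^ 2 / π := by
    field_simp
    ring
  rw [hsq] at hexpand
  linarith

lemma intervalIntegrable_inv_sqrt_mul_one_sub :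
    IntervalIntegrable (fun t : ℝ => (√(t * (1 - t)))⁻¹) volume 0 1 := by
  have h := (Complex.betaIntegral_convergent (u := 1 / 2) (v := 1 / 2)
    (by norm_num) (by norm_num)).norm
  rw [intervalIntegrable_iff_integrableOn_Ioo_of_le zero_le_one] at h ⊢
  refine h.congr_fun (fun t ht => ?_) measurableSet_Ioo
  have h1 : 0 < 1 - t := sub_pos.2 ht.2
  have h2 : (1 - t : ℂ) = ((1 - t : ℝ) : ℂ) := by push_cast; rfl
  have h3 : ((1 : ℂ) / 2 - 1).re = -(1 / 2) := by
    rw [Complex.sub_re, Complex.one_re, show ((1 : ℂ) / 2) = ((1 / 2 : ℝ) : ℂ) by push_cast; rfl,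
      Complex.ofReal_re]
    norm_num
  dsimp only
  rw [norm_mul, h2, Complex.norm_cpow_eq_rpow_re_of_pos ht.1,
    Complex.norm_cpow_eq_rpow_re_of_pos h1, h3, ← Real.mul_rpow ht.1.le h1.le,
    Real.rpow_neg (mul_pos ht.1 h1).le, Real.sqrt_eq_rpow]

lemma exists_norm_Impz_ray_le {m p : ℕ} (hm : 0 < m) (hp : 0 < p) (z : ℂ) {θ : ℝ}
    (hθ : θ ∈ Ioo (-π) π) :
    ∃ A, 0 ≤ A ∧ ∀ r : ℝ, 0 ≤ r →
      ‖Impz m p z ((r : ℂ) * Complex.exp (Complex.I * θ))‖ ≤ A * Real.exp (r / π) := by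
  obtain ⟨A, hA, hbound⟩ := exists_norm_Phimpz_ray_le hm hp z hθ
  have hB : 0 ≤ ∫ t in (0 : ℝ)..1, (√(t * (1 - t)))⁻¹ :=
    intervalIntegral.integral_nonneg zero_le_one fun t _ => by positivity
  set B := ∫ t in (0 : ℝ)..1, (√(t * (1 - t)))⁻¹
  refine ⟨‖(1 / (2 * ((√π : ℝ) : ℂ)))‖ * (B * A), by positivity, fun r hr => ?_⟩
  rw [Impz, norm_mul, mul_assoc]
  gcongr
  have hint : IntervalIntegrable (fun t : ℝ => (√(t * (1 - t)))⁻¹ * (A * Real.exp (r / π)))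
      volume 0 1 := intervalIntegrable_inv_sqrt_mul_one_sub.mul_const _
  refine (intervalIntegral.norm_integral_le_of_norm_le zero_le_one
    (ae_of_all _ fun t ht => ?_) hint).trans_eq ?_
  · rw [norm_mul, norm_inv, Complex.norm_real, Real.norm_eq_abs, abs_of_nonneg (Real.sqrt_nonneg _)]
    gcongr
    have h := hbound (t * r) (mul_nonneg ht.1.le hr)
    rw [Complex.ofReal_mul, mul_assoc] at h
    refine h.trans ?_
    gcongr
    exact mul_le_of_le_one_left hr ht.2
  · rw [intervalIntegral.integral_mul_const, mul_assoc]

lemma measurable_Phimpz (m p : ℕ) (z : ℂ) : Measurable (Phimpz m p z) := by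
  have hF : Measurable (Fmpz m p z) := by
    unfold Fmpz
    split_ifs <;> fun_prop
  exact hF.comp (measurable_id.pow_const _)

lemma measurable_Impz (m p : ℕ) (z : ℂ) : Measurable (Impz m p z) := by
  have hΦ := measurable_Phimpz m p z
  have h : Measurable fun q : ℂ × ℝ =>
      ((√(q.2 * (1 - q.2)) : ℝ) : ℂ)⁻¹ * Phimpz m p z ((q.2 : ℂ) * q.1) := by fun_prop
  unfold Impz
  simp only [intervalIntegral.integral_of_le zero_le_one]
  exact (h.stronglyMeasurable.integral_prod_right
    (ν := volume.restrict (Ioc 0 1))).measurable.const_mul _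

lemma measurable_convBorel {f g : ℂ → ℂ} (hf : Measurable f) (hg : Measurable g) :
    Measurable (convBorel f g) := by
  have h : Measurable fun q : ℂ × ℝ =>
      f ((1 - (q.2 : ℂ)) * q.1) * g ((q.2 : ℂ) * q.1) := by fun_prop
  unfold convBorel
  simp only [intervalIntegral.integral_of_le zero_le_one]
  exact measurable_id.mul
    (h.stronglyMeasurable.integral_prod_right (ν := volume.restrict (Ioc 0 1))).measurable

/-- A Borel transform `H = ∑ cₙ ξⁿ / n!` of a series summable at `ρ` has exponential type
at most `1 / ρ`. -/
lemma exists_norm_borel_le {c : ℕ → ℂ} {ρ : ℝ} (hρ : 0 < ρ)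
    (hc : Summable fun n => c n * (ρ : ℂ) ^ n) {H : ℂ → ℂ}
    (hH : ∀ ξ : ℂ, HasSum (fun n : ℕ => c n / (n ! : ℂ) * ξ ^ n) (H ξ)) :
    ∃ C, 0 ≤ C ∧ ∀ ξ, ‖H ξ‖ ≤ C * Real.exp (‖ξ‖ / ρ) := by
  obtain ⟨C, hC⟩ := hc.tendsto_atTop_zero.norm.bddAbove_range
  have hC' (n : ℕ) : ‖c n‖ * ρ ^ n ≤ C := by
    have := hC (mem_range_self n)
    rwa [norm_mul, norm_pow, Complex.norm_real, Real.norm_eq_abs, abs_of_pos hρ] at this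
  refine ⟨C, (by positivity : 0 ≤ ‖c 0‖ * ρ ^ 0).trans (hC' 0), fun ξ => ?_⟩
  have hexp : HasSum (fun n : ℕ => C * ((‖ξ‖ / ρ) ^ n / n !)) (C * Real.exp (‖ξ‖ / ρ)) := by
    rw [Real.exp_eq_exp_ℝ]
    exact (NormedSpace.expSeries_div_hasSum_exp (‖ξ‖ / ρ)).mul_left C
  rw [← (hH ξ).tsum_eq]
  refine tsum_of_norm_bounded hexp fun n => ?_
  rw [norm_mul, norm_div, norm_pow, Complex.norm_natCast, div_pow]
  calc ‖c n‖ / n ! * ‖ξ‖ ^ n = (‖c n‖ * ρ ^ n) * (‖ξ‖ ^ n / ρ ^ n / n !) := by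
        field_simp
    _ ≤ _ := by
        gcongr
        exact hC' n

lemma measurable_of_hasSum_pow {a : ℕ → ℂ} {H : ℂ → ℂ}
    (hH : ∀ ξ : ℂ, HasSum (fun n : ℕ => a n * ξ ^ n) (H ξ)) : Measurable H :=
  measurable_of_tendsto_metrizable
    (f := fun N ξ => ∑ n ∈ Finset.range N, a n * ξ ^ n)
    (fun N => by fun_prop)
    (tendsto_pi_nhds.2 fun ξ => (hH ξ).tendsto_sum_nat)

lemma norm_convBorel_ray_le {f g : ℂ → ℂ} {C D a : ℝ} (hC : 0 ≤ C) {e : ℂ} (he : ‖e‖ = 1)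
    (hf : ∀ ξ, ‖f ξ‖ ≤ C * Real.exp (‖ξ‖ / a))
    (hg : ∀ r : ℝ, 0 ≤ r → ‖g ((r : ℂ) * e)‖ ≤ D * Real.exp (r / a))
    {r : ℝ} (hr : 0 ≤ r) :
    ‖convBorel f g ((r : ℂ) * e)‖ ≤ C * D * r * Real.exp (r / a) := by
  have hx : ‖(r : ℂ) * e‖ = r := by
    rw [norm_mul, he, mul_one, Complex.norm_real, Real.norm_eq_abs, abs_of_nonneg hr]
  have hint : ‖∫ t in (0 : ℝ)..1, f ((1 - (t : ℂ)) * ((r : ℂ) * e)) * g ((t : ℂ) * ((r : ℂ) * e))‖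
      ≤ C * D * Real.exp (r / a) * |1 - 0| := by
    refine intervalIntegral.norm_integral_le_of_norm_le_const fun t ht => ?_
    rw [uIoc_of_le zero_le_one] at ht
    have h1 := hf ((1 - (t : ℂ)) * ((r : ℂ) * e))
    have h2 := hg (t * r) (mul_nonneg ht.1.le hr)
    have h3 : ‖(1 - (t : ℂ))‖ = 1 - t := by
      rw [← Complex.ofReal_one, ← Complex.ofReal_sub, Complex.norm_real, Real.norm_eq_abs,
        abs_of_nonneg (sub_nonneg.2 ht.2)]
    rw [norm_mul, hx, h3] at h1
    rw [Complex.ofReal_mul, mul_assoc] at h2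
    rw [norm_mul]
    refine (mul_le_mul h1 h2 (norm_nonneg _) (by positivity)).trans_eq ?_
    rw [mul_mul_mul_comm, ← Real.exp_add]
    congr 2
    ring
  rw [convBorel, norm_mul, hx]
  calc _ ≤ r * (C * D * Real.exp (r / a) * |1 - 0|) := by gcongr
    _ = _ := by norm_num; ring

/-- A measurable function of growth `O(r e^{ar})` has an absolutely convergent Laplace integral
in the half-plane of real part larger than `a`. -/
lemma integrableOn_exp_mul_of_norm_le {f : ℝ → ℂ} (hf : Measurable f) {C a : ℝ} {s : ℂ}
    (has : a < s.re) (hbound : ∀ r, 0 ≤ r → ‖f r‖ ≤ C * r * Real.exp (a * r)) :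
    IntegrableOn (fun r : ℝ => Complex.exp (-(r * s)) * f r) (Ici 0) := by
  have hδ : 0 < s.re - a := sub_pos.2 has
  rw [integrableOn_Ici_iff_integrableOn_Ioi]
  have hmaj : IntegrableOn (fun r : ℝ => C * (r ^ (1 : ℝ) * Real.exp (-(s.re - a) * r)))
      (Ioi 0) := by
    have := integrableOn_rpow_mul_exp_neg_mul_rpow (s := 1) (p := 1) (by norm_num) one_pos hδ
    simp only [Real.rpow_one] at this ⊢
    exact this.const_mul C
  refine hmaj.mono' (by fun_prop) ?_
  filter_upwards [ae_restrict_mem measurableSet_Ioi] with r hr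
  rw [norm_mul, Complex.norm_exp, Complex.neg_re, Complex.re_ofReal_mul, Real.rpow_one]
  calc _ ≤ Real.exp (-(r * s.re)) * (C * r * Real.exp (a * r)) := by
        gcongr
        exact hbound r (le_of_lt hr)
    _ = C * r * (Real.exp (-(r * s.re)) * Real.exp (a * r)) := by ring
    _ = _ := by
        rw [← Real.exp_add, mul_assoc]
        congr 3
        ring

/-- For `2z+1` not a non-zero integer, in every direction `e^{iθ}` with `θ ∈ (-π,π)`
and for every `h ≠ 0` with `Re(e^{iθ}/h) > 1/π`, the Laplace integral of the Borel
transform `H_{m,p} * I_{m,p,z}` converges absolutely, and such `h` exist: the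
`z`-coloured Jones series of the `(m,p)`-torus knot is Borel re-summable. -/
theorem stmt14 (m p : ℕ) (hm : 2 ≤ m) (hp : 2 ≤ p) (hcop : Nat.Coprime m p)
    (z : ℂ) (hz : ¬ ∃ n : ℤ, n ≠ 0 ∧ 2 * z + 1 = (n : ℂ))
    (c : ℕ → ℂ)
    (hc : ∀ h : ℂ, ‖h‖ < 2 * Real.pi → h ≠ 0 →
      HasSum (fun n : ℕ => c n * h ^ n)
        ((1 / (2 * ((Real.sqrt Real.pi : ℝ) : ℂ))) * h *
          Complex.exp (-(h / 4) * (((p : ℂ) / (m : ℂ)) + ((m : ℂ) / (p : ℂ)))) /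
          Complex.sinh (h / 2)))
    (H : ℂ → ℂ)
    (hH : ∀ ξ : ℂ, HasSum (fun n : ℕ => c n / ((n.factorial : ℕ) : ℂ) * ξ ^ n) (H ξ)) :
    ∀ θ : ℝ, θ ∈ Set.Ioo (-Real.pi) Real.pi →
      (∀ h : ℂ, h ≠ 0 → 1 / Real.pi < (Complex.exp (Complex.I * (θ : ℂ)) / h).re →
        IntegrableOn
          (fun r : ℝ =>
            Complex.exp (-((r : ℂ) * Complex.exp (Complex.I * (θ : ℂ))) / h) *
              convBorel H (Impz m p z) ((r : ℂ) * Complex.exp (Complex.I * (θ : ℂ))) *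
              Complex.exp (Complex.I * (θ : ℂ)))
          (Set.Ici (0 : ℝ)) volume) ∧
      ∃ h : ℂ, h ≠ 0 ∧ 1 / Real.pi < (Complex.exp (Complex.I * (θ : ℂ)) / h).re := by
  intro θ hθ
  set e := Complex.exp (Complex.I * (θ : ℂ)) with he
  have hnorm : ‖e‖ = 1 := by rw [he, mul_comm, Complex.norm_exp_ofReal_mul_I]
  have hpi : ‖(π : ℂ)‖ < 2 * π := by
    rw [Complex.norm_real, Real.norm_eq_abs, abs_of_pos Real.pi_pos]
    linarith [Real.pi_pos]
  obtain ⟨C, hC, hHb⟩ := exists_norm_borel_le Real.pi_pos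
    (hc π hpi (by exact_mod_cast Real.pi_ne_zero)).summable hH
  obtain ⟨D, -, hIb⟩ :=
    exists_norm_Impz_ray_le (m := m) (p := p) (by omega) (by omega) z hθ
  have hmeas : Measurable fun r : ℝ => convBorel H (Impz m p z) ((r : ℂ) * e) :=
    (measurable_convBorel (measurable_of_hasSum_pow hH) (measurable_Impz m p z)).comp
      (by fun_prop)
  refine ⟨fun h _ hre => ?_, π / 2 * e, ?_, ?_⟩
  · refine IntegrableOn.congr_fun (Integrable.mul_const
      (integrableOn_exp_mul_of_norm_le (C := C * D) hmeas hre fun r hr => ?_) e)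
      (fun r _ => ?_) measurableSet_Ici
    · rw [one_div_mul_eq_div]
      exact norm_convBorel_ray_le hC hnorm hHb hIb hr
    · rw [neg_div, mul_div_assoc]
  · exact mul_ne_zero (by exact_mod_cast (by positivity : π / 2 ≠ 0)) (Complex.exp_ne_zero _)
  · have h : e / (π / 2 * e) = ((2 / π : ℝ) : ℂ) := by
      have : e ≠ 0 := Complex.exp_ne_zero _
      have : (π : ℂ) ≠ 0 := by exact_mod_cast Real.pi_ne_zero
      push_cast
      field_simp
    rw [h, Complex.ofReal_re]
    have := Real.pi_pos
    gcongr
    norm_num
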